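/- (Corollary 5) Let a binary linear block code satisfy d_{min,i} = d_min for every i ∈ {0,…,k-1} (e.g., a cyclic code). Then under BPSK transmission over an AWGN channel with noise variance σ², every decoder ψ satisfies BER_ψ ≥ Q(√d_min / σ). -/

import Mathlib

open MeasureTheory ProbabilityTheory

/-- The Gaussian tail function `Q(x) = ∫_x^∞ (1/√(2π)) e^{-t²/2} dt`. -/
noncomputable def Qfun (x : ℝ) : ℝ :=
  ∫ t in Set.Ioi x, (1 / Real.sqrt (2 * Real.pi)) * Real.exp (-(t ^ 2) / 2)

/-- BPSK modulation: bit `b ↦ (-1)^b`. -/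
noncomputable def bpsk (b : ZMod 2) : ℝ := if b = 0 then 1 else -1

open scoped ENNReal NNReal

section PiWithDensity

variable {ι : Type*} [Fintype ι]

/-- A product of measures with integrable densities has the product of the densities as its
density. -/
theorem pi_withDensity_ofReal {α : ι → Type*} [∀ i, MeasurableSpace (α i)]
    (μ : ∀ i, Measure (α i)) [∀ i, SigmaFinite (μ i)] (f : ∀ i, α i → ℝ)
    (hf : ∀ i, Integrable (f i) (μ i)) (hf0 : ∀ i x, 0 ≤ f i x) :
    Measure.pi (fun i => (μ i).withDensity fun x => ENNReal.ofReal (f i x)) =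
      (Measure.pi μ).withDensity fun x => ENNReal.ofReal (∏ i, f i (x i)) := by
  have (i : ι) : SigmaFinite ((μ i).withDensity fun x => ENNReal.ofReal (f i x)) :=
    SigmaFinite.withDensity_ofReal (f i)
  refine Measure.pi_eq fun s hs => ?_
  have hint : Integrable (fun x : ∀ i, α i => ∏ i, f i (x i))
      (Measure.pi fun i => (μ i).restrict (s i)) :=
    Integrable.fintype_prod_dep fun i => (hf i).restrict
  rw [withDensity_apply _ (.univ_pi hs), Measure.restrict_pi_pi,
    ← ofReal_integral_eq_lintegral_ofReal hint
      (ae_of_all _ fun x => Finset.prod_nonneg fun i _ => hf0 i _),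
    integral_fintype_prod_eq_prod,
    ENNReal.ofReal_prod_of_nonneg fun i _ => integral_nonneg (hf0 i)]
  refine Finset.prod_congr rfl fun i _ => ?_
  rw [withDensity_apply _ (hs i),
    ofReal_integral_eq_lintegral_ofReal (hf i).restrict (ae_of_all _ (hf0 i))]

end PiWithDensity

section GaussianVector

variable {ι : Type*} [Fintype ι]

/-- On a set of points closer to `a` than to `b`, the Gaussian vector centred at `b` has at most
the mass of the Gaussian vector centred at `a`. -/
theorem pi_gaussianReal_le_of_sum_sq_le (a b : ι → ℝ) {v : ℝ≥0} (hv : v ≠ 0)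
    {s : Set (ι → ℝ)} (hs : MeasurableSet s)
    (h : ∀ y ∈ s, ∑ i, (y i - a i) ^ 2 ≤ ∑ i, (y i - b i) ^ 2) :
    Measure.pi (fun i => gaussianReal (b i) v) s ≤
      Measure.pi (fun i => gaussianReal (a i) v) s := by
  have density (m : ι → ℝ) : Measure.pi (fun i => gaussianReal (m i) v) =
      (Measure.pi fun _ => volume).withDensity
        fun y => ENNReal.ofReal (∏ i, gaussianPDFReal (m i) v (y i)) := by
    rw [← pi_withDensity_ofReal _ _ (fun i => integrable_gaussianPDFReal (m i) v)
      (fun i => gaussianPDFReal_nonneg (m i) v)]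
    simp_rw [gaussianReal_of_var_ne_zero _ hv, gaussianPDF_def]
  rw [density, density, withDensity_apply _ hs, withDensity_apply _ hs]
  refine setLIntegral_mono' hs fun y hy => ENNReal.ofReal_le_ofReal ?_
  simp only [gaussianPDFReal, Finset.prod_mul_distrib, ← Real.exp_sum, ← Finset.sum_div,
    Finset.sum_neg_distrib]
  have := h y hy
  gcongr

theorem pi_gaussianReal_map_sum (m : ι → ℝ) (v : ι → ℝ≥0) :
    (Measure.pi fun i => gaussianReal (m i) (v i)).map (fun x => ∑ i, x i) =
      gaussianReal (∑ i, m i) (∑ i, v i) := by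
  have hlaw (i : ι) : (Measure.pi fun i => gaussianReal (m i) (v i)).map (fun x => x i) =
      gaussianReal (m i) (v i) := (measurePreserving_eval _ i).map_eq
  have hgauss : HasGaussianLaw (fun x : ι → ℝ => ∑ i, x i)
      (Measure.pi fun i => gaussianReal (m i) (v i)) :=
    iIndepFun.hasGaussianLaw_fun_sum (X := fun i (x : ι → ℝ) => x i)
      (fun i => ⟨by rw [hlaw]; infer_instance⟩)
      (iIndepFun_pi (X := fun _ => id) fun _ => aemeasurable_id)
  have hmean : ∫ x : ι → ℝ, ∑ i, x i ∂(Measure.pi fun i => gaussianReal (m i) (v i)) =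
      ∑ i, m i := by
    rw [integral_finsetSum]
    · simp [integral_eval]
    · exact fun i _ => integrable_eval ((memLp_id_gaussianReal 1).integrable le_rfl)
  have hvar : Var[fun x : ι → ℝ => ∑ i, x i; Measure.pi fun i => gaussianReal (m i) (v i)] =
      ∑ i, (v i : ℝ) := by
    have := variance_sum_pi (μ := fun i => gaussianReal (m i) (v i)) (X := fun _ => id)
      fun i => memLp_id_gaussianReal 2
    simp only [variance_id_gaussianReal] at this
    rw [← this]
    congr 1
    ext x
    simp
  rw [hgauss.map_eq_gaussianReal, hmean, hvar]
  congr 1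
  rw [← NNReal.coe_sum, Real.toNNReal_coe]

theorem pi_gaussianReal_map_sum_mul (c : ι → ℝ) (v : ℝ≥0) :
    (Measure.pi fun _ : ι => gaussianReal 0 v).map (fun z => ∑ i, c i * z i) =
      gaussianReal 0 ((∑ i, c i ^ 2).toNNReal * v) := by
  have hscale : (Measure.pi fun _ : ι => gaussianReal 0 v).map (fun z i => c i * z i) =
      Measure.pi fun i => gaussianReal 0 ((c i ^ 2).toNNReal * v) := by
    rw [Measure.pi_map_pi (f := fun i x => c i * x) fun i => by fun_prop]
    simp only [gaussianReal_map_const_mul, mul_zero]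
    congr! with i
    exact (Real.toNNReal_of_nonneg (sq_nonneg _)).symm
  have hsum := pi_gaussianReal_map_sum (fun _ : ι => 0) fun i => (c i ^ 2).toNNReal * v
  rw [← hscale, Measure.map_map (by fun_prop) (by fun_prop), Finset.sum_const_zero,
    ← Finset.sum_mul, ← Real.toNNReal_sum_of_nonneg fun i _ => sq_nonneg _] at hsum
  exact hsum

theorem pi_gaussianReal_map_add (m : ι → ℝ) (v : ℝ≥0) :
    (Measure.pi fun _ : ι => gaussianReal 0 v).map (fun z i => m i + z i) =
      Measure.pi fun i => gaussianReal (m i) v := by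
  have (i : ι) : SigmaFinite ((gaussianReal 0 v).map (m i + ·)) := by
    rw [gaussianReal_map_const_add]; infer_instance
  rw [Measure.pi_map_pi (f := fun i x => m i + x) fun i => by fun_prop]
  simp only [gaussianReal_map_const_add, zero_add]

end GaussianVector

section BinaryTest

theorem ofReal_Qfun_eq_gaussianReal (x : ℝ) :
    ENNReal.ofReal (Qfun x) = gaussianReal 0 1 (Set.Ioi x) := by
  rw [gaussianReal_apply_eq_integral _ one_ne_zero]
  simp [Qfun, gaussianPDFReal]

theorem gaussianReal_Ioi_eq_ofReal_Qfun {s : ℝ} (hs : 0 < s) (t : ℝ) :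
    gaussianReal 0 (s ^ 2).toNNReal (Set.Ioi t) = ENNReal.ofReal (Qfun (t / s)) := by
  have h := gaussianReal_map_const_mul (μ := 0) (v := 1) s
  rw [mul_zero, mul_one] at h
  rw [Real.toNNReal_of_nonneg (sq_nonneg s), ofReal_Qfun_eq_gaussianReal]
  refine (congrArg (fun μ : Measure ℝ => μ (Set.Ioi t)) h.symm).trans ?_
  rw [Measure.map_apply (by fun_prop) measurableSet_Ioi]
  congr 1
  ext x
  simp [div_lt_iff₀ hs, mul_comm]

variable {ι : Type*} [Fintype ι]

/-- The probability that a Gaussian vector centred at `a` is closer to `b` than to `a`. -/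
theorem pi_gaussianReal_closer {a b : ι → ℝ} {σ d : ℝ} (hσ : 0 < σ) (hd : 0 < d)
    (hab : ∑ i, (a i - b i) ^ 2 = 4 * d) :
    Measure.pi (fun i => gaussianReal (a i) (σ ^ 2).toNNReal)
      {y | ∑ i, (y i - b i) ^ 2 < ∑ i, (y i - a i) ^ 2} =
      ENNReal.ofReal (Qfun (√d / σ)) := by
  have hmeas : MeasurableSet {y : ι → ℝ | ∑ i, (y i - b i) ^ 2 < ∑ i, (y i - a i) ^ 2} :=
    measurableSet_lt (by fun_prop) (by fun_prop)
  have hba : ∑ i, (b i - a i) ^ 2 = 4 * d := by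
    rw [← hab]; exact Finset.sum_congr rfl fun i _ => by ring
  have hpre : (fun (z : ι → ℝ) i => a i + z i) ⁻¹'
      {y : ι → ℝ | ∑ i, (y i - b i) ^ 2 < ∑ i, (y i - a i) ^ 2} =
      (fun z : ι → ℝ => ∑ i, (b i - a i) * z i) ⁻¹' Set.Ioi (2 * d) := by
    ext z
    have hexp : ∑ i, (a i + z i - b i) ^ 2 =
        ∑ i, (a i + z i - a i) ^ 2 - 2 * ∑ i, (b i - a i) * z i + 4 * d := by
      rw [← hba, Finset.mul_sum, ← Finset.sum_sub_distrib, ← Finset.sum_add_distrib]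
      exact Finset.sum_congr rfl fun i _ => by ring
    simp only [Set.mem_preimage, Set.mem_ofPred_eq, Set.mem_Ioi, hexp]
    constructor <;> intro h <;> linarith
  have hsq : (4 * d).toNNReal * (σ ^ 2).toNNReal = ((2 * √d * σ) ^ 2).toNNReal := by
    rw [← Real.toNNReal_mul (by positivity), mul_pow, mul_pow, Real.sq_sqrt hd.le]
    norm_num
  have hdiv : 2 * d / (2 * √d * σ) = √d / σ := by
    have := Real.sqrt_pos.2 hd
    field_simp
    rw [Real.sq_sqrt hd.le]
  rw [← pi_gaussianReal_map_add, Measure.map_apply (by fun_prop) hmeas, hpre,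
    ← Measure.map_apply (by fun_prop) measurableSet_Ioi, pi_gaussianReal_map_sum_mul, hba, hsq,
    gaussianReal_Ioi_eq_ofReal_Qfun (by positivity), hdiv]

/-- The two error probabilities of any binary test between Gaussian vectors centred at `a` and
`b` add up to at least those of the minimum-distance test. -/
theorem two_mul_ofReal_Qfun_le_add {a b : ι → ℝ} {σ d : ℝ} (hσ : 0 < σ) (hd : 0 < d)
    (hab : ∑ i, (a i - b i) ^ 2 = 4 * d) {s : Set (ι → ℝ)} (hs : MeasurableSet s) :
    2 * ENNReal.ofReal (Qfun (√d / σ)) ≤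
      Measure.pi (fun i => gaussianReal (a i) (σ ^ 2).toNNReal) sᶜ +
        Measure.pi (fun i => gaussianReal (b i) (σ ^ 2).toNNReal) s := by
  have hv : (σ ^ 2).toNNReal ≠ 0 := (Real.toNNReal_pos.2 (by positivity)).ne'
  have hba : ∑ i, (b i - a i) ^ 2 = 4 * d := by
    rw [← hab]; exact Finset.sum_congr rfl fun i _ => by ring
  have ha := pi_gaussianReal_closer hσ hd hab
  have hb := pi_gaussianReal_closer hσ hd hba
  set μ := Measure.pi fun i => gaussianReal (a i) (σ ^ 2).toNNReal
  set ν := Measure.pi fun i => gaussianReal (b i) (σ ^ 2).toNNReal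
  set t : Set (ι → ℝ) := {y | ∑ i, (y i - b i) ^ 2 < ∑ i, (y i - a i) ^ 2}
  have ht : MeasurableSet t := measurableSet_lt (by fun_prop) (by fun_prop)
  have htc : {y : ι → ℝ | ∑ i, (y i - a i) ^ 2 < ∑ i, (y i - b i) ^ 2} ⊆ tᶜ :=
    fun y hy => by
      simp only [t, Set.mem_compl_iff, Set.mem_ofPred_eq, not_lt] at hy ⊢
      exact hy.le
  have hle₁ : μ (t ∩ s) ≤ ν (t ∩ s) :=
    pi_gaussianReal_le_of_sum_sq_le b a hv (ht.inter hs) fun y hy => le_of_lt hy.1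
  have hle₂ : ν (tᶜ \ s) ≤ μ (tᶜ \ s) :=
    pi_gaussianReal_le_of_sum_sq_le a b hv (ht.compl.diff hs) fun y hy => not_lt.1 hy.1
  calc 2 * ENNReal.ofReal (Qfun (√d / σ))
      ≤ μ t + ν tᶜ := by
        rw [two_mul]
        exact add_le_add ha.ge (hb.ge.trans (measure_mono htc))
    _ = μ (t ∩ s) + μ (t \ s) + (ν (tᶜ ∩ s) + ν (tᶜ \ s)) := by
        rw [measure_inter_add_sdiff _ hs, measure_inter_add_sdiff _ hs]
    _ ≤ ν (t ∩ s) + μ (t \ s) + (ν (tᶜ ∩ s) + μ (tᶜ \ s)) := by gcongr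
    _ = (μ (sᶜ ∩ t) + μ (sᶜ \ t)) + (ν (s ∩ t) + ν (s \ t)) := by
        simp only [Set.sdiff_eq, Set.inter_comm sᶜ, Set.inter_comm s]
        ring
    _ = μ sᶜ + ν s := by
        rw [measure_inter_add_sdiff _ ht, measure_inter_add_sdiff _ ht]

end BinaryTest

section Code

variable {ι κ : Type*} [Fintype ι] [Fintype κ]

theorem bpsk_sub_bpsk_add_sq (x y : ZMod 2) :
    (bpsk x - bpsk (x + y)) ^ 2 = if y ≠ 0 then 4 else 0 := by
  have cases_bit : ∀ z : ZMod 2, z = 0 ∨ z = 1 := by decide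
  rcases cases_bit x with rfl | rfl <;> rcases cases_bit y with rfl | rfl <;>
    simp [bpsk, CharTwo.add_self_eq_zero] <;> norm_num

theorem sum_bpsk_sub_bpsk_add_sq (x y : ι → ZMod 2) :
    ∑ j, (bpsk (x j) - bpsk ((x + y) j)) ^ 2 = 4 * hammingNorm y := by
  simp only [Pi.add_apply, bpsk_sub_bpsk_add_sq, hammingNorm, Finset.sum_ite,
    Finset.sum_const_zero, Finset.sum_const, nsmul_eq_mul, add_zero, mul_comm]

/-- Averaging over all information vectors, paired by translation along `w`, bounds the error
probability at a position `i` with `w i = 1`. -/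
theorem ofReal_Qfun_le_bit_error [DecidableEq κ] (G : Matrix κ ι (ZMod 2)) {σ : ℝ} (hσ : 0 < σ)
    {w : κ → ZMod 2} {i : κ} (hw : w i = 1) (hpos : 0 < hammingNorm (Matrix.vecMul w G))
    {ψ : (ι → ℝ) → κ → ZMod 2} (hψ : Measurable ψ) :
    ENNReal.ofReal (Qfun (√(hammingNorm (Matrix.vecMul w G)) / σ)) ≤
      ((PMF.uniformOfFintype (κ → ZMod 2)).toMeasure.prod
        (Measure.pi fun _ : ι => gaussianReal 0 (σ ^ 2).toNNReal))
        {ω | ψ (fun j => bpsk (Matrix.vecMul ω.1 G j) + ω.2 j) i ≠ ω.1 i} := by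
  set q := ENNReal.ofReal (Qfun (√(hammingNorm (Matrix.vecMul w G)) / σ))
  let e (u : κ → ZMod 2) : ℝ≥0∞ :=
    Measure.pi (fun j => gaussianReal (bpsk (Matrix.vecMul u G j)) (σ ^ 2).toNNReal)
      {y | ψ y i ≠ u i}
  have hψi : Measurable fun y => ψ y i := (measurable_pi_apply i).comp hψ
  have hdec (b : ZMod 2) : MeasurableSet {y | ψ y i = b} := hψi (measurableSet_singleton b)
  have hpair (u : κ → ZMod 2) : 2 * q ≤ e u + e (u + w) := by
    have hset : {y | ψ y i ≠ (u + w) i} = {y | ψ y i = u i} := by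
      ext y
      have : ∀ x z : ZMod 2, x ≠ z + 1 ↔ x = z := by decide
      simp [hw, this]
    have := two_mul_ofReal_Qfun_le_add (a := fun j => bpsk (Matrix.vecMul u G j))
      (b := fun j => bpsk (Matrix.vecMul (u + w) G j)) hσ (Nat.cast_pos.2 hpos)
      (by rw [Matrix.add_vecMul]; exact sum_bpsk_sub_bpsk_add_sq _ _) (hdec (u i))
    simp only [e, hset]
    exact this
  have hsum : (Fintype.card (κ → ZMod 2) : ℝ≥0∞) * q ≤ ∑ u, e u := by
    have h : ∑ _u : κ → ZMod 2, 2 * q ≤ ∑ u, (e u + e (u + w)) :=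
      Finset.sum_le_sum fun u _ => hpair u
    have htranslate : ∑ u, e (u + w) = ∑ u, e u :=
      Fintype.sum_equiv (Equiv.addRight w) _ _ fun _ => rfl
    rw [Finset.sum_add_distrib, htranslate, ← two_mul, ← Finset.mul_sum,
      ENNReal.mul_le_mul_iff_right two_ne_zero ENNReal.ofNat_ne_top] at h
    simpa using h
  have henc (j : ι) : Measurable fun u : κ → ZMod 2 => bpsk (Matrix.vecMul u G j) :=
    measurable_of_countable _
  have hmeas : MeasurableSet {ω : (κ → ZMod 2) × (ι → ℝ) |
      ψ (fun j => bpsk (Matrix.vecMul ω.1 G j) + ω.2 j) i ≠ ω.1 i} := by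
    refine (measurableSet_eq_fun (hψi.comp (measurable_pi_lambda _ fun j => ?_)) ?_).compl
    · exact ((henc j).comp measurable_fst).add
        ((measurable_pi_apply j).comp measurable_snd)
    · exact (measurable_pi_apply i).comp measurable_fst
  have hsection (u : κ → ZMod 2) :
      (Measure.pi fun _ : ι => gaussianReal 0 (σ ^ 2).toNNReal)
        (Prod.mk u ⁻¹' {ω : (κ → ZMod 2) × (ι → ℝ) |
          ψ (fun j => bpsk (Matrix.vecMul ω.1 G j) + ω.2 j) i ≠ ω.1 i}) = e u := by
    simp only [e]
    rw [← pi_gaussianReal_map_add fun j => bpsk (Matrix.vecMul u G j)]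
    exact (Measure.map_apply (by fun_prop) (hdec (u i)).compl).symm
  rw [Measure.prod_apply hmeas, lintegral_fintype]
  simp only [hsection, PMF.toMeasure_apply_singleton _ _ (measurableSet_singleton _),
    PMF.uniformOfFintype_apply]
  rw [← Finset.sum_mul, ← div_eq_mul_inv,
    ENNReal.le_div_iff_mul_le (by simp) (by simp), mul_comm]
  exact hsum

end Code

/-- (Corollary 5) Let a binary linear block code satisfy `d_{min,i} = d_min` for every
`i ∈ {0,…,k-1}` (e.g. a cyclic code). Then under BPSK transmission over an AWGN channel
with noise variance `σ²`, every (measurable) decoder `ψ` satisfies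
`BER_ψ ≥ Q(√d_min / σ)`. -/
theorem ber_lower_bound_equal_dmin_i
    (n k : ℕ) (hk : 1 ≤ k) (hkn : k ≤ n) (σ : ℝ) (hσ : 0 < σ)
    -- generator matrix of rank `k`, i.e. with linearly independent rows
    (G : Matrix (Fin k) (Fin n) (ZMod 2))
    (hG : LinearIndependent (ZMod 2) (fun i => G i))
    -- `d_{min,i} = d_min` for every `i`: the minimum Hamming weight of `uG` over `u`
    -- with `u_i = 1` equals `d_min` for every bit position `i`
    (dmin : ℕ)
    (hdmin : ∀ i : Fin k, IsLeast {w : ℕ | ∃ u : Fin k → ZMod 2, u i = 1 ∧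
        hammingNorm (Matrix.vecMul u G) = w} dmin)
    -- the underlying probability measure: `U` uniform, independent i.i.d. Gaussian noise
    (P : Measure ((Fin k → ZMod 2) × (Fin n → ℝ)))
    (hP : P = ((PMF.uniformOfFintype (Fin k → ZMod 2)).toMeasure).prod
        (Measure.pi fun _ : Fin n => gaussianReal 0 ((σ ^ 2).toNNReal)))
    -- the received vector `Y_j = (-1)^{(UG)_j} + Z_j`
    (Y : (Fin k → ZMod 2) × (Fin n → ℝ) → Fin n → ℝ)
    (hY : Y = fun ω j => bpsk (Matrix.vecMul ω.1 G j) + ω.2 j)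
    -- the decoder and its bit-error probability
    (ψ : (Fin n → ℝ) → Fin k → ZMod 2) (hψ : Measurable ψ)
    (BER : ℝ)
    (hBER : BER = (1 / (k : ℝ)) * ∑ i : Fin k, (P {ω | ψ (Y ω) i ≠ ω.1 i}).toReal) :
    Qfun (Real.sqrt (dmin : ℝ) / σ) ≤ BER := by
  have : Nonempty (Fin k) := ⟨⟨0, hk⟩⟩
  have hinj : Function.Injective G.vecMul := Matrix.vecMul_injective_iff.2 hG
  have hbit (i : Fin k) :
      Qfun (Real.sqrt (dmin : ℝ) / σ) ≤ (P {ω | ψ (Y ω) i ≠ ω.1 i}).toReal := by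
    obtain ⟨w, hw, rfl⟩ := (hdmin i).1
    have hpos : 0 < hammingNorm (Matrix.vecMul w G) := by
      rw [hammingNorm_pos_iff]
      intro h
      have hw0 : w = 0 := hinj (h.trans (Matrix.zero_vecMul G).symm)
      simp [hw0] at hw
    subst hP hY
    exact (ENNReal.ofReal_le_iff_le_toReal (measure_ne_top _ _)).1
      (ofReal_Qfun_le_bit_error G hσ hw hpos hψ)
  have hk0 : (0 : ℝ) < k := by exact_mod_cast hk
  have hsum := Finset.card_nsmul_le_sum Finset.univ _ _ fun i _ => hbit i
  rw [Finset.card_univ, Fintype.card_fin, nsmul_eq_mul] at hsum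
  rw [hBER, one_div, inv_mul_eq_div, le_div_iff₀ hk0, mul_comm]
  exact hsum
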